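/- Let μ be a positive Borel measure on ℝ with ∫ dμ(t)/(t²+1) < ∞, let F_μ(z) = a + bz + ∫ (1/(t−z) − t/(t²+1)) dμ(t) (a ∈ ℝ, b ≥ 0) be an associated Herglotz function, and let ξ be its Krein function, ξ(x) = (1/π) lim_{y→0+} Im ln F_μ(x+iy), where the branch of the logarithm with 0 < Im ln w < π for w ∈ ℂ⁺ is used (ξ(x) is defined for Lebesgue-a.e. x and 0 ≤ ξ ≤ 1). Fix x ∈ ℝ. Then μ({x}) > 0 if and only if ∫_{x−1}^{x+1} |ξ(t) − χ_{(x,∞)}(t)|/|t−x| dt < ∞. -/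

import Mathlib

open MeasureTheory Filter Topology

/-- The Herglotz function associated with a positive Borel measure `μ` on `ℝ`
(satisfying `∫ dμ(t)/(t²+1) < ∞`) and constants `a ∈ ℝ`, `b ≥ 0`:
`F(z) = a + b z + ∫ (1/(t - z) - t/(t² + 1)) dμ(t)`. -/
noncomputable def herglotzFn (μ : Measure ℝ) (a b : ℝ) (z : ℂ) : ℂ :=
  (a : ℂ) + (b : ℂ) * z +
    ∫ t : ℝ, (((t : ℂ) - z)⁻¹ - (t : ℂ) / ((t : ℂ) ^ 2 + 1)) ∂μ

open Complex in
/-- Cauchy's theorem for the upper half plane, for functions that decay quadratically. -/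
theorem integral_real_eq_zero_of_decay {G : ℂ → ℂ} (hG : DifferentiableOn ℂ G {z | 0 ≤ z.im})
    (hInt : Integrable fun t : ℝ => G t) {C R₀ : ℝ}
    (hbound : ∀ z : ℂ, 0 ≤ z.im → R₀ ≤ ‖z‖ → ‖G z‖ ≤ C / ‖z‖ ^ 2) :
    ∫ t : ℝ, G t = 0 := by
  have hlim : Tendsto (fun R : ℝ => ∫ t in (-R)..R, G t) atTop (𝓝 (∫ t : ℝ, G t)) :=
    intervalIntegral_tendsto_integral hInt tendsto_neg_atTop_atBot tendsto_id
  have hzero : Tendsto (fun R : ℝ => ∫ t in (-R)..R, G t) atTop (𝓝 0) := by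
    refine squeeze_zero_norm' (a := fun R => 4 * |C| / R) ?_
      (tendsto_const_nhds.div_atTop tendsto_id)
    filter_upwards [eventually_ge_atTop R₀, eventually_gt_atTop 0] with R hR hR0
    have key := integral_boundary_rect_eq_zero_of_differentiableOn G (⟨-R, 0⟩ : ℂ) ⟨R, R⟩
      (hG.mono fun z hz => by
        have := hz.2
        simp only [Set.mem_preimage, Set.uIcc_of_le hR0.le, Set.mem_Icc] at this
        exact this.1)
    simp only [ofReal_zero, zero_mul, add_zero, ofReal_neg] at key
    have hpt : ∀ z : ℂ, 0 ≤ z.im → R ≤ ‖z‖ → ‖G z‖ ≤ |C| / R ^ 2 := fun z hz hzR =>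
      (hbound z hz (hR.trans hzR)).trans (by gcongr; exact le_abs_self C)
    have htop : ‖∫ t : ℝ in (-R)..R, G (t + R * I)‖ ≤ |C| / R ^ 2 * |R - -R| := by
      refine intervalIntegral.norm_integral_le_of_norm_le_const fun t _ => hpt _ ?_ ?_
      · simpa using hR0.le
      · simpa [abs_of_pos hR0] using abs_im_le_norm ((t : ℂ) + R * I)
    have hright : ‖∫ s : ℝ in (0 : ℝ)..R, G (R + s * I)‖ ≤ |C| / R ^ 2 * |R - 0| := by
      refine intervalIntegral.norm_integral_le_of_norm_le_const fun s hs => hpt _ ?_ ?_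
      · rw [Set.uIoc_of_le hR0.le] at hs
        simpa using hs.1.le
      · simpa [abs_of_pos hR0] using abs_re_le_norm ((R : ℂ) + s * I)
    have hleft : ‖∫ s : ℝ in (0 : ℝ)..R, G (-R + s * I)‖ ≤ |C| / R ^ 2 * |R - 0| := by
      refine intervalIntegral.norm_integral_le_of_norm_le_const fun s hs => hpt _ ?_ ?_
      · rw [Set.uIoc_of_le hR0.le] at hs
        simpa using hs.1.le
      · simpa [abs_of_pos hR0] using abs_re_le_norm (-(R : ℂ) + s * I)
    have heq : ∫ t : ℝ in (-R)..R, G t = (∫ t : ℝ in (-R)..R, G (t + R * I))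
        - I • (∫ s : ℝ in (0 : ℝ)..R, G (R + s * I))
        + I • (∫ s : ℝ in (0 : ℝ)..R, G (-R + s * I)) := by
      linear_combination key
    rw [heq]
    have hsum : 4 * |C| / R = |C| / R ^ 2 * |R - -R| + |C| / R ^ 2 * |R - 0|
        + |C| / R ^ 2 * |R - 0| := by
      rw [sub_neg_eq_add, sub_zero, abs_of_pos hR0, abs_of_pos (by linarith : 0 < R + R)]
      field_simp
      ring
    rw [hsum]
    refine (norm_add_le _ _).trans (add_le_add ((norm_sub_le _ _).trans (add_le_add htop ?_)) ?_)
    · simpa [norm_smul] using hright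
    · simpa [norm_smul] using hleft
  exact tendsto_nhds_unique hlim hzero

/-- The real part on the imaginary axis of the Schwarz kernel, normalised at `i`. -/
noncomputable def schwarzKernel (y t : ℝ) : ℝ := t / (t ^ 2 + y ^ 2) - t / (t ^ 2 + 1)

theorem schwarzKernel_eq {y : ℝ} (hy : 0 < y) (t : ℝ) :
    schwarzKernel y t = t * ((1 - y ^ 2) / ((t ^ 2 + y ^ 2) * (t ^ 2 + 1))) := by
  have : 0 < t ^ 2 + y ^ 2 := by positivity
  unfold schwarzKernel
  field_simp
  ring

theorem abs_schwarzKernel {y : ℝ} (hy : 0 < y) (hy1 : y < 1) (t : ℝ) :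
    |schwarzKernel y t| = |t| * ((1 - y ^ 2) / ((t ^ 2 + y ^ 2) * (t ^ 2 + 1))) := by
  have : 0 < 1 - y ^ 2 := by nlinarith
  rw [schwarzKernel_eq hy, abs_mul, abs_of_nonneg (a := _ / _) (by positivity)]

theorem continuous_schwarzKernel {y : ℝ} (hy : 0 < y) : Continuous (schwarzKernel y) := by
  unfold schwarzKernel
  have h1 : ∀ t : ℝ, t ^ 2 + y ^ 2 ≠ 0 := fun t => by positivity
  have h2 : ∀ t : ℝ, t ^ 2 + 1 ≠ 0 := fun t => by positivity
  fun_prop (disch := assumption)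

theorem one_add_abs_mul_abs_schwarzKernel_le {y : ℝ} (hy : 0 < y) (hy1 : y < 1) (t : ℝ) :
    (1 + |t|) * |schwarzKernel y t| ≤ 2 / y ^ 2 * (1 + t ^ 2)⁻¹ := by
  rw [abs_schwarzKernel hy hy1]
  have h1 : (1 + |t|) * |t| ≤ 2 * (1 + t ^ 2) := by nlinarith [sq_abs t, sq_nonneg (|t| - 1)]
  have h2 : y ^ 2 * (1 + t ^ 2) ≤ t ^ 2 + y ^ 2 := by
    have : y ^ 2 ≤ 1 := by nlinarith
    nlinarith [sq_nonneg t]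
  have h3 : 1 - y ^ 2 ≤ 1 := by nlinarith
  have h4 : 0 ≤ 1 - y ^ 2 := by nlinarith
  calc (1 + |t|) * (|t| * ((1 - y ^ 2) / ((t ^ 2 + y ^ 2) * (t ^ 2 + 1))))
      = ((1 + |t|) * |t|) * ((1 - y ^ 2) / ((t ^ 2 + y ^ 2) * (t ^ 2 + 1))) := by ring
    _ ≤ (2 * (1 + t ^ 2)) * (1 / ((y ^ 2 * (1 + t ^ 2)) * (t ^ 2 + 1))) := by gcongr
    _ = 2 / y ^ 2 * (1 + t ^ 2)⁻¹ := by
      field_simp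
      ring

theorem integrable_schwarzKernel {y : ℝ} (hy : 0 < y) (hy1 : y < 1) :
    Integrable (schwarzKernel y) := by
  refine (integrable_inv_one_add_sq.const_mul (2 / y ^ 2)).mono'
    (continuous_schwarzKernel hy).aestronglyMeasurable (ae_of_all _ fun t => ?_)
  refine le_trans ?_ (one_add_abs_mul_abs_schwarzKernel_le hy hy1 t)
  rw [Real.norm_eq_abs]
  exact le_mul_of_one_le_left (abs_nonneg _) (by linarith [abs_nonneg t])

theorem integrable_div_sq_add_sq_of_pos {y : ℝ} (hy : 0 < y) :
    Integrable fun t : ℝ => y / (t ^ 2 + y ^ 2) := by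
  have h := (integrable_inv_one_add_sq.comp_mul_left' (inv_ne_zero hy.ne')).const_mul y⁻¹
  refine h.congr (ae_of_all _ fun t => ?_)
  have : 0 < t ^ 2 + y ^ 2 := by positivity
  have : 0 < y ^ 2 + t ^ 2 := by positivity
  field_simp
  ring

theorem integral_univ_div_sq_add_sq {y : ℝ} (hy : 0 < y) :
    ∫ t : ℝ, y / (t ^ 2 + y ^ 2) = Real.pi := by
  have h := Measure.integral_comp_mul_left (fun t : ℝ => (1 + t ^ 2)⁻¹) y⁻¹
  rw [integral_univ_inv_one_add_sq, inv_inv, abs_of_pos hy, smul_eq_mul] at h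
  have h2 : ∀ t : ℝ, y / (t ^ 2 + y ^ 2) = y⁻¹ * (1 + (y⁻¹ * t) ^ 2)⁻¹ := fun t => by
    have : 0 < t ^ 2 + y ^ 2 := by positivity
    have : 0 < y ^ 2 + t ^ 2 := by positivity
    field_simp
    ring
  simp_rw [h2]
  rw [integral_const_mul, h]
  field_simp

open Complex in
/-- Schwarz's formula on the imaginary axis, for functions of at most linear growth. -/
theorem integral_mul_schwarzKernel {H : ℂ → ℂ} (hH : DifferentiableOn ℂ H {z | 0 ≤ z.im})
    {M : ℝ} (hM : ∀ z : ℂ, 0 ≤ z.im → ‖H z‖ ≤ M * (1 + ‖z‖)) {y : ℝ} (hy : 0 < y) (hy1 : y < 1) :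
    Integrable (fun t : ℝ => H t * schwarzKernel y t) ∧
      ∫ t : ℝ, H t * schwarzKernel y t = Real.pi * I * (H (y * I) - H I) := by
  have hM0 : 0 ≤ M := by simpa using (norm_nonneg _).trans (hM 0 (by simp))
  have hHc : Continuous fun t : ℝ => H t :=
    hH.continuousOn.comp_continuous continuous_ofReal fun t => by simp
  have hInt : Integrable (fun t : ℝ => H t * schwarzKernel y t) := by
    refine (integrable_inv_one_add_sq.const_mul (M * (2 / y ^ 2))).mono'
      (hHc.mul (continuous_ofReal.comp (continuous_schwarzKernel hy))).aestronglyMeasurable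
      (ae_of_all _ fun t => ?_)
    have h1 := hM t (by simp)
    rw [norm_real, Real.norm_eq_abs] at h1
    rw [norm_mul, norm_real, Real.norm_eq_abs, mul_assoc]
    calc ‖H t‖ * |schwarzKernel y t| ≤ M * (1 + |t|) * |schwarzKernel y t| := by gcongr
      _ = M * ((1 + |t|) * |schwarzKernel y t|) := by ring
      _ ≤ M * (2 / y ^ 2 * (1 + t ^ 2)⁻¹) :=
        mul_le_mul_of_nonneg_left (one_add_abs_mul_abs_schwarzKernel_le hy hy1 t) hM0
  refine ⟨hInt, ?_⟩
  set P : ℂ → ℂ := fun z => z * H z with hP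
  have hPd : DifferentiableOn ℂ P {z | 0 ≤ z.im} := differentiableOn_id.mul hH
  have hnhds : ∀ w : ℂ, 0 < w.im → {z : ℂ | 0 ≤ z.im} ∈ 𝓝 w := fun w hw =>
    mem_of_superset ((isOpen_lt continuous_const continuous_im).mem_nhds hw)
      fun z (hz : 0 < z.im) => hz.le
  have hne : ∀ (c : ℝ), 0 < c → ∀ z : ℂ, 0 ≤ z.im → z + c * I ≠ 0 := fun c hc z hz h => by
    have := congrArg im h
    simp at this
    linarith
  set G : ℂ → ℂ := fun z => dslope P (y * I) z / (z + y * I) - dslope P I z / (z + (1 : ℝ) * I)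
    with hGdef
  have hGd : DifferentiableOn ℂ G {z | 0 ≤ z.im} := by
    refine DifferentiableOn.sub (DifferentiableOn.div ?_ (by fun_prop) fun z hz => hne y hy z hz)
      (DifferentiableOn.div ?_ (by fun_prop) fun z hz => hne 1 one_pos z hz)
    · exact (differentiableOn_dslope (hnhds _ (by simpa using hy))).2 hPd
    · exact (differentiableOn_dslope (hnhds _ (by simp))).2 hPd
  have hGeq : ∀ z : ℂ, 0 ≤ z.im → z ≠ y * I → z ≠ I →
      G z = H z * (z * ((1 - y ^ 2) / ((z ^ 2 + y ^ 2) * (z ^ 2 + 1))))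
        - H (y * I) * (I * (y / (z ^ 2 + y ^ 2))) + H I * (I * (1 / (z ^ 2 + 1))) := by
    intro z hz hz1 hz2
    have e1 : z ^ 2 + y ^ 2 = (z - y * I) * (z + y * I) := by linear_combination (y : ℂ) ^ 2 * I_sq
    have e2 : z ^ 2 + 1 = (z - I) * (z + I) := by linear_combination I_sq
    have n1 := sub_ne_zero.2 hz1
    have n2 := sub_ne_zero.2 hz2
    have n3 := hne y hy z hz
    have n4 := hne 1 one_pos z hz
    simp only [hGdef, hP, dslope_of_ne _ hz1, dslope_of_ne _ hz2, slope_def_field, ofReal_one,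
      one_mul] at n4 ⊢
    rw [e1, e2]
    field_simp
    linear_combination H z * z * (y ^ 2 - 1) * I_sq
  have hGreal : ∀ t : ℝ, G t = H t * schwarzKernel y t - H (y * I) * (I * (y / (t ^ 2 + y ^ 2) : ℝ))
      + H I * (I * (1 / (t ^ 2 + 1 ^ 2) : ℝ)) := by
    intro t
    rw [hGeq t (by simp), schwarzKernel_eq hy]
    · push_cast
      ring
    · intro h
      have := congrArg im h
      simp at this
      linarith
    · intro h
      have := congrArg im h
      simp at this
  have hI1 : Integrable fun t : ℝ => H (y * I) * (I * ((y / (t ^ 2 + y ^ 2) : ℝ) : ℂ)) :=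
    ((integrable_div_sq_add_sq_of_pos hy).ofReal.const_mul _).const_mul _
  have hI2 : Integrable fun t : ℝ => H I * (I * ((1 / (t ^ 2 + 1 ^ 2) : ℝ) : ℂ)) :=
    ((integrable_div_sq_add_sq_of_pos one_pos).ofReal.const_mul _).const_mul _
  have hzero : ∫ t : ℝ, G t = 0 := by
    refine integral_real_eq_zero_of_decay hGd (R₀ := 2)
      (C := 8 * M + ‖H (y * I)‖ * 2 + ‖H I‖ * 2) ?_ ?_
    · simp_rw [hGreal]
      exact (hInt.sub hI1).add hI2
    · intro z hz hz2
      have hne1 : z ≠ y * I := by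
        rintro rfl
        simp [abs_of_pos hy] at hz2
        linarith
      have hne2 : z ≠ I := by
        rintro rfl
        norm_num at hz2
      rw [hGeq z hz hne1 hne2]
      have hlow : ∀ c : ℝ, 0 < c → c ≤ 1 → ‖z‖ ^ 2 / 2 ≤ ‖z ^ 2 + (c : ℂ) ^ 2‖ := by
        intro c hc hc1
        have := norm_sub_le (z ^ 2 + (c : ℂ) ^ 2) ((c : ℂ) ^ 2)
        rw [add_sub_cancel_right, norm_pow, norm_pow, norm_real, Real.norm_eq_abs,
          abs_of_pos hc] at this
        nlinarith
      have hl1 := hlow y hy hy1.le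
      have hl2 : ‖z‖ ^ 2 / 2 ≤ ‖z ^ 2 + 1‖ := by simpa using hlow 1 one_pos le_rfl
      have hz0 : 0 < ‖z‖ := by linarith
      have hn : ‖(1 - y ^ 2 : ℂ)‖ ≤ 1 := by
        rw [show (1 - y ^ 2 : ℂ) = ((1 - y ^ 2 : ℝ) : ℂ) by push_cast; rfl, norm_real,
          Real.norm_eq_abs, abs_le]
        constructor <;> nlinarith
      rw [add_div, add_div]
      refine (norm_add_le _ _).trans (add_le_add ((norm_sub_le _ _).trans (add_le_add ?_ ?_)) ?_)
      · rw [norm_mul, norm_mul, norm_div, norm_mul]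
        calc ‖H z‖ * (‖z‖ * (‖(1 - y ^ 2 : ℂ)‖ / (‖z ^ 2 + (y : ℂ) ^ 2‖ * ‖z ^ 2 + 1‖)))
            ≤ (M * (‖z‖ + ‖z‖)) * (‖z‖ * (1 / (‖z‖ ^ 2 / 2 * (‖z‖ ^ 2 / 2)))) := by
              gcongr
              exact (hM z hz).trans (by gcongr; linarith)
          _ = 8 * M / ‖z‖ ^ 2 := by
              field_simp
              ring
      · rw [norm_mul, norm_mul, norm_div, norm_I, one_mul, norm_real, Real.norm_eq_abs,
          abs_of_pos hy]
        calc ‖H (y * I)‖ * (y / ‖z ^ 2 + (y : ℂ) ^ 2‖) ≤ ‖H (y * I)‖ * (1 / (‖z‖ ^ 2 / 2)) := by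
              gcongr
          _ = ‖H (y * I)‖ * 2 / ‖z‖ ^ 2 := by
              field_simp
      · rw [norm_mul, norm_mul, norm_div, norm_I, one_mul, norm_one]
        calc ‖H I‖ * (1 / ‖z ^ 2 + 1‖) ≤ ‖H I‖ * (1 / (‖z‖ ^ 2 / 2)) := by gcongr
          _ = ‖H I‖ * 2 / ‖z‖ ^ 2 := by
              field_simp
  simp_rw [hGreal] at hzero
  rw [integral_add (by exact hInt.sub hI1) hI2, integral_sub hInt hI1, integral_const_mul, integral_const_mul,
    integral_const_mul, integral_const_mul, integral_complex_ofReal, integral_complex_ofReal,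
    integral_univ_div_sq_add_sq hy, integral_univ_div_sq_add_sq one_pos] at hzero
  linear_combination hzero

theorem aemeasurable_and_mem_Icc_of_tendsto_arg {F : ℂ → ℂ}
    (hd : DifferentiableOn ℂ F {z | 0 < z.im}) (him : ∀ z : ℂ, 0 < z.im → 0 < (F z).im)
    {ξ : ℝ → ℝ}
    (hξ : ∀ᵐ t : ℝ, Tendsto (fun h : ℝ => (Complex.log (F (t + h * Complex.I))).im)
      (𝓝[>] 0) (𝓝 (Real.pi * ξ t))) :
    AEMeasurable ξ ∧ ∀ᵐ t : ℝ, 0 ≤ ξ t ∧ ξ t ≤ 1 := by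
  constructor
  · have hmeas : ∀ h : Set.Ioi (0 : ℝ), AEMeasurable fun t : ℝ =>
        (Complex.log (F (t + (h : ℝ) * Complex.I))).im := by
      intro h
      have h0 : (0 : ℝ) < h := h.2
      refine (Complex.measurable_im.comp (Complex.measurable_log.comp ?_)).aemeasurable
      exact (hd.continuousOn.comp_continuous (by fun_prop) fun t => by simpa using h0).measurable
    have := aemeasurable_of_tendsto_metrizable_ae (μ := volume)
      (comap ((↑) : Set.Ioi (0 : ℝ) → ℝ) (𝓝[>] 0)) hmeas
      (g := fun t => Real.pi * ξ t) (hu := by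
        rw [comap_neBot_iff]
        intro s hs
        obtain ⟨a, ha, ha'⟩ :=
          nonempty_of_mem (inter_mem hs (self_mem_nhdsWithin : Set.Ioi (0 : ℝ) ∈ 𝓝[>] 0))
        exact ⟨⟨a, ha'⟩, ha⟩)
      (hξ.mono fun t ht => ht.comp tendsto_comap)
    refine (this.const_mul Real.pi⁻¹).congr (ae_of_all _ fun t => ?_)
    field_simp
  · filter_upwards [hξ] with t ht
    have hev : ∀ᶠ h : ℝ in 𝓝[>] 0, (Complex.log (F (t + h * Complex.I))).im ∈
        Set.Icc 0 Real.pi := by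
      filter_upwards [self_mem_nhdsWithin] with h hh
      rw [Complex.log_im]
      exact ⟨Complex.arg_nonneg_iff.2 (him _ (by simpa using hh)).le, Complex.arg_le_pi _⟩
    have := isClosed_Icc.mem_of_tendsto ht hev
    constructor
    · exact nonneg_of_mul_nonneg_right this.1 Real.pi_pos
    · nlinarith [this.2, Real.pi_pos]

open Complex in
theorem integral_krein_mul_schwarzKernel {F : ℂ → ℂ}
    (hd : DifferentiableOn ℂ F {z | 0 < z.im}) (him : ∀ z : ℂ, 0 < z.im → 0 < (F z).im)
    (hgrow : ∀ h : ℝ, 0 < h → ∃ M, ∀ z : ℂ, h ≤ z.im → ‖log (F z)‖ ≤ M * (1 + ‖z‖))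
    {ξ : ℝ → ℝ}
    (hξ : ∀ᵐ t : ℝ, Tendsto (fun h : ℝ => (log (F (t + h * I))).im) (𝓝[>] 0) (𝓝 (Real.pi * ξ t)))
    {y : ℝ} (hy : 0 < y) (hy1 : y < 1) :
    ∫ t : ℝ, ξ t * schwarzKernel y t = Real.log ‖F (y * I)‖ - Real.log ‖F I‖ := by
  have hstep : ∀ h : ℝ, 0 < h → ∫ t : ℝ, (log (F (t + h * I))).im * schwarzKernel y t =
      Real.pi * (Real.log ‖F (y * I + h * I)‖ - Real.log ‖F (I + h * I)‖) := by
    intro h hh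
    obtain ⟨M, hM⟩ := hgrow h hh
    have hM0 : 0 ≤ M := by
      have := (norm_nonneg _).trans (hM (h * I) (by simp))
      exact nonneg_of_mul_nonneg_left this (by positivity)
    have hmaps : ∀ z : ℂ, 0 ≤ z.im → 0 < (z + h * I).im := fun z hz => by
      simp
      linarith
    obtain ⟨hInt, hval⟩ := integral_mul_schwarzKernel (H := fun z => log (F (z + h * I)))
      (M := M * (1 + h)) (DifferentiableOn.clog
        (hd.comp (by fun_prop) fun z hz => hmaps z hz)
        fun z hz => Or.inr (him _ (hmaps z hz)).ne') (fun z hz => by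
          refine (hM _ (by simpa using hz)).trans ?_
          have h1 := norm_add_le z (h * I)
          rw [norm_mul, norm_I, norm_real, Real.norm_eq_abs, abs_of_pos hh, mul_one] at h1
          rw [mul_assoc]
          gcongr
          nlinarith [norm_nonneg z]) hy hy1
    have hre := imCLM.integral_comp_comm hInt
    rw [hval] at hre
    simp only [imCLM_apply, im_mul_ofReal] at hre
    rw [hre]
    simp [log_re]
  have hpos : ∀ c : ℝ, 0 < c → Tendsto (fun h : ℝ => Real.log ‖F (c * I + h * I)‖) (𝓝[>] 0)
      (𝓝 (Real.log ‖F (c * I)‖)) := by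
    intro c hc
    have hcim : (0 : ℝ) < (c * I : ℂ).im := by simpa using hc
    have hF : ContinuousAt F (c * I) := (hd.differentiableAt
      ((isOpen_lt continuous_const continuous_im).mem_nhds hcim)).continuousAt
    have hne : F (c * I) ≠ 0 := fun h => by
      have := him _ hcim
      simp [h] at this
    have hlin : Tendsto (fun h : ℝ => (c * I + h * I : ℂ)) (𝓝[>] 0) (𝓝 (c * I)) := by
      refine tendsto_nhdsWithin_of_tendsto_nhds (Continuous.tendsto' (by fun_prop) _ _ (by simp))
    exact ((Real.continuousAt_log (norm_ne_zero_iff.2 hne)).tendsto.comp hF.norm.tendsto).comp hlin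
  have hl1 := ((hpos y hy).sub (hpos 1 one_pos)).const_mul Real.pi
  have hl2 : Tendsto (fun h : ℝ => ∫ t : ℝ, (log (F (t + h * I))).im * schwarzKernel y t) (𝓝[>] 0)
      (𝓝 (∫ t : ℝ, Real.pi * ξ t * schwarzKernel y t)) := by
    refine tendsto_integral_filter_of_dominated_convergence
      (fun t => Real.pi * |schwarzKernel y t|) ?_ ?_
      ((integrable_schwarzKernel hy hy1).abs.const_mul _) ?_
    · filter_upwards [self_mem_nhdsWithin] with h hh
      have hF : Continuous fun t : ℝ => F (t + h * I) :=
        hd.continuousOn.comp_continuous (by fun_prop) fun t => by simpa using hh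
      exact ((measurable_im.comp (measurable_log.comp hF.measurable)).mul
        (continuous_schwarzKernel hy).measurable).aestronglyMeasurable
    · refine Eventually.of_forall fun h => ae_of_all _ fun t => ?_
      rw [norm_mul, Real.norm_eq_abs, Real.norm_eq_abs, log_im]
      gcongr
      exact abs_arg_le_pi _
    · filter_upwards [hξ] with t ht
      exact ht.mul_const _
  have huniq := tendsto_nhds_unique hl2 (hl1.congr' (by
    filter_upwards [self_mem_nhdsWithin] with h hh
    rw [hstep h hh]
    simp))
  simp_rw [mul_assoc] at huniq
  rw [integral_const_mul] at huniq
  have := mul_left_cancel₀ Real.pi_ne_zero huniq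
  simpa using this

theorem setIntegral_Ioi_schwarzKernel {y : ℝ} (hy : 0 < y) (hy1 : y < 1) :
    ∫ t in Set.Ioi 0, schwarzKernel y t = -Real.log y := by
  have hderiv : ∀ t : ℝ, HasDerivAt
      (fun t => (Real.log (t ^ 2 + y ^ 2) - Real.log (t ^ 2 + 1)) / 2) (schwarzKernel y t) t := by
    intro t
    have h1 : ∀ c : ℝ, 0 < c → HasDerivAt (fun t => Real.log (t ^ 2 + c)) (2 * t / (t ^ 2 + c)) t :=
      fun c hc => by
        simpa using ((hasDerivAt_pow 2 t).add_const c).log (by positivity)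
    refine (((h1 (y ^ 2) (by positivity)).sub (h1 1 one_pos)).div_const 2).congr_deriv ?_
    unfold schwarzKernel
    ring
  have hlim : Tendsto (fun t : ℝ => (Real.log (t ^ 2 + y ^ 2) - Real.log (t ^ 2 + 1)) / 2) atTop
      (𝓝 0) := by
    have h1 : Tendsto (fun t : ℝ => 1 - (1 - y ^ 2) / (t ^ 2 + 1)) atTop (𝓝 1) := by
      simpa using (tendsto_const_nhds (x := (1 : ℝ))).sub
        ((tendsto_const_nhds (x := 1 - y ^ 2)).div_atTop
          (tendsto_atTop_add_const_right _ 1 (tendsto_pow_atTop (α := ℝ) two_ne_zero)))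
    have h2 := ((Real.continuousAt_log one_ne_zero).tendsto.comp h1).div_const 2
    rw [Real.log_one, zero_div] at h2
    refine h2.congr fun t => ?_
    rw [← Real.log_div (by positivity) (by positivity), Function.comp_apply]
    congr 2
    field_simp
    ring
  rw [integral_Ioi_of_hasDerivAt_of_tendsto' (fun t _ => hderiv t)
    (integrable_schwarzKernel hy hy1).integrableOn hlim]
  simp

theorem abs_mul_abs_schwarzKernel_le {y : ℝ} (hy : 0 < y) (hy1 : y < 1) (t : ℝ) :
    |t| * |schwarzKernel y t| ≤ (t ^ 2 + 1)⁻¹ := by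
  have h1 : t ^ 2 * (1 - y ^ 2) ≤ t ^ 2 + y ^ 2 := by nlinarith [sq_nonneg t, sq_nonneg (t * y)]
  calc |t| * |schwarzKernel y t|
      = t ^ 2 * (1 - y ^ 2) / (t ^ 2 + y ^ 2) * (t ^ 2 + 1)⁻¹ := by
        rw [abs_schwarzKernel hy hy1, ← mul_assoc, abs_mul_abs_self]
        field_simp
    _ ≤ 1 * (t ^ 2 + 1)⁻¹ := by
        gcongr
        exact (div_le_one (by positivity)).2 h1
    _ = (t ^ 2 + 1)⁻¹ := one_mul _

theorem tendsto_abs_schwarzKernel {t : ℝ} (ht : t ≠ 0) :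
    Tendsto (fun y => |schwarzKernel y t|) (𝓝[>] 0) (𝓝 (|t|⁻¹ * (t ^ 2 + 1)⁻¹)) := by
  have hc : ContinuousAt (fun y => |schwarzKernel y t|) 0 := by
    unfold schwarzKernel
    have : t ^ 2 + (0 : ℝ) ^ 2 ≠ 0 := by positivity
    fun_prop (disch := assumption)
  have hv : |schwarzKernel 0 t| = |t|⁻¹ * (t ^ 2 + 1)⁻¹ := by
    have : schwarzKernel 0 t = t⁻¹ * (t ^ 2 + 1)⁻¹ := by
      unfold schwarzKernel
      field_simp
      ring
    rw [this, abs_mul, abs_inv, abs_of_pos (a := (t ^ 2 + 1)⁻¹) (by positivity)]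
  rw [← hv]
  exact hc.tendsto.mono_left nhdsWithin_le_nhds

open Complex in
theorem lintegral_krein_sub_indicator_mul_schwarzKernel {F : ℂ → ℂ}
    (hd : DifferentiableOn ℂ F {z | 0 < z.im}) (him : ∀ z : ℂ, 0 < z.im → 0 < (F z).im)
    (hgrow : ∀ h : ℝ, 0 < h → ∃ M, ∀ z : ℂ, h ≤ z.im → ‖log (F z)‖ ≤ M * (1 + ‖z‖))
    {ξ : ℝ → ℝ}
    (hξ : ∀ᵐ t : ℝ, Tendsto (fun h : ℝ => (log (F (t + h * I))).im) (𝓝[>] 0) (𝓝 (Real.pi * ξ t)))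
    {y : ℝ} (hy : 0 < y) (hy1 : y < 1) :
    ∫⁻ t : ℝ, ENNReal.ofReal
        (|ξ t - (Set.Ioi 0).indicator (fun _ => (1 : ℝ)) t| * |schwarzKernel y t|) =
      ENNReal.ofReal (Real.log ‖F I‖ - Real.log (y * ‖F (y * I)‖)) := by
  obtain ⟨hmeas, hbd⟩ := aemeasurable_and_mem_Icc_of_tendsto_arg hd him hξ
  have hK := integrable_schwarzKernel hy hy1
  have hξK : Integrable fun t => ξ t * schwarzKernel y t := by
    refine hK.bdd_mul (c := 1) hmeas.aestronglyMeasurable ?_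
    filter_upwards [hbd] with t ht
    rw [Real.norm_eq_abs, abs_le]
    constructor <;> linarith [ht.1, ht.2]
  have hχK : Integrable fun t => (Set.Ioi 0).indicator (fun _ => (1 : ℝ)) t * schwarzKernel y t := by
    refine (hK.indicator measurableSet_Ioi (s := Set.Ioi 0)).congr (ae_of_all _ fun t => ?_)
    by_cases ht : t ∈ Set.Ioi (0 : ℝ) <;> simp [Set.indicator, ht]
  have hae : (fun t => (Set.Ioi 0).indicator (fun _ => (1 : ℝ)) t * schwarzKernel y t
      - ξ t * schwarzKernel y t) =ᵐ[volume] fun t =>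
      |ξ t - (Set.Ioi 0).indicator (fun _ => (1 : ℝ)) t| * |schwarzKernel y t| := by
    filter_upwards [hbd] with t ht
    have hpos : 0 ≤ (1 - y ^ 2) / ((t ^ 2 + y ^ 2) * (t ^ 2 + 1)) := by
      have : 0 ≤ 1 - y ^ 2 := by nlinarith
      positivity
    rw [abs_schwarzKernel hy hy1, schwarzKernel_eq hy]
    by_cases h : 0 < t
    · rw [Set.indicator_of_mem (Set.mem_Ioi.2 h), abs_of_nonpos (by linarith [ht.2]), abs_of_pos h]
      ring
    · rw [Set.indicator_of_notMem (by simpa using h), sub_zero, abs_of_nonneg ht.1,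
        abs_of_nonpos (not_lt.1 h)]
      ring
  have hInt : ∫ t, |ξ t - (Set.Ioi 0).indicator (fun _ => (1 : ℝ)) t| * |schwarzKernel y t| =
      Real.log ‖F I‖ - Real.log (y * ‖F (y * I)‖) := by
    have hχ : ∫ t, (Set.Ioi 0).indicator (fun _ => (1 : ℝ)) t * schwarzKernel y t = -Real.log y := by
      rw [← setIntegral_Ioi_schwarzKernel hy hy1, ← integral_indicator measurableSet_Ioi]
      congr 1 with t
      by_cases ht : t ∈ Set.Ioi (0 : ℝ) <;> simp [Set.indicator, ht]
    have hne : ‖F (y * I)‖ ≠ 0 := norm_ne_zero_iff.2 fun h => by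
      have := him (y * I) (by simpa using hy)
      simp [h] at this
    rw [← integral_congr_ae hae, integral_sub hχK hξK, hχ,
      integral_krein_mul_schwarzKernel hd him hgrow hξ hy hy1, Real.log_mul hy.ne' hne]
    ring
  rw [← hInt, ofReal_integral_eq_lintegral_ofReal ((hχK.sub hξK).congr hae)
    (ae_of_all _ fun t => by positivity)]

open Complex in
/-- The point mass at `0` of a Herglotz function, read off from its Krein function. -/
theorem pos_iff_lintegral_krein_lt_top {F : ℂ → ℂ}
    (hd : DifferentiableOn ℂ F {z | 0 < z.im}) (him : ∀ z : ℂ, 0 < z.im → 0 < (F z).im)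
    (hgrow : ∀ h : ℝ, 0 < h → ∃ M, ∀ z : ℂ, h ≤ z.im → ‖log (F z)‖ ≤ M * (1 + ‖z‖))
    {ξ : ℝ → ℝ}
    (hξ : ∀ᵐ t : ℝ, Tendsto (fun h : ℝ => (log (F (t + h * I))).im) (𝓝[>] 0) (𝓝 (Real.pi * ξ t)))
    {m : ℝ} (hm : Tendsto (fun y : ℝ => y * ‖F (y * I)‖) (𝓝[>] 0) (𝓝 m)) :
    0 < m ↔ ∫⁻ t in Set.Ioo (-1) 1,
      ENNReal.ofReal (|ξ t - (Set.Ioi 0).indicator (fun _ => (1 : ℝ)) t| / |t|) < ⊤ := by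
  obtain ⟨hmeas, hbd⟩ := aemeasurable_and_mem_Icc_of_tendsto_arg hd him hξ
  have key := fun y => lintegral_krein_sub_indicator_mul_schwarzKernel hd him hgrow hξ (y := y)
  set D : ℝ → ℝ := fun t => |ξ t - (Set.Ioi 0).indicator (fun _ => (1 : ℝ)) t| with hD
  have hDmeas : AEMeasurable D :=
    (hmeas.sub (measurable_const.indicator measurableSet_Ioi).aemeasurable).abs
  have hD0 : ∀ t, 0 ≤ D t := fun t => abs_nonneg _
  have hsmall : ∀ᶠ y : ℝ in 𝓝[>] 0, y ∈ Set.Ioo (0 : ℝ) 1 := Ioo_mem_nhdsGT one_pos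
  have hne : ∀ᵐ t : ℝ, t ≠ 0 := Measure.ae_ne volume 0
  constructor
  · intro hmpos
    have hfatou : ∫⁻ t, ENNReal.ofReal (D t * (|t|⁻¹ * (t ^ 2 + 1)⁻¹)) ≤
        ENNReal.ofReal (Real.log ‖F I‖ - Real.log (m / 2)) := by
      calc ∫⁻ t, ENNReal.ofReal (D t * (|t|⁻¹ * (t ^ 2 + 1)⁻¹))
          = ∫⁻ t, liminf (fun y => ENNReal.ofReal (D t * |schwarzKernel y t|)) (𝓝[>] 0) := by
            refine lintegral_congr_ae ?_
            filter_upwards [hne] with t ht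
            exact (ENNReal.tendsto_ofReal
              ((tendsto_abs_schwarzKernel ht).const_mul (D t))).liminf_eq.symm
        _ ≤ liminf (fun y => ∫⁻ t, ENNReal.ofReal (D t * |schwarzKernel y t|)) (𝓝[>] 0) := by
            refine lintegral_liminf_le' fun y => (hDmeas.mul ?_).ennreal_ofReal
            unfold schwarzKernel
            fun_prop
        _ ≤ _ := by
            refine liminf_le_of_frequently_le' (Eventually.frequently ?_)
            filter_upwards [hsmall, hm.eventually_const_lt (half_lt_self hmpos)] with y hy hmy
            rw [key y hy.1 hy.2]
            gcongr
    calc ∫⁻ t in Set.Ioo (-1) 1, ENNReal.ofReal (D t / |t|)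
        ≤ ∫⁻ t in Set.Ioo (-1) 1, 2 * ENNReal.ofReal (D t * (|t|⁻¹ * (t ^ 2 + 1)⁻¹)) := by
          refine setLIntegral_mono' measurableSet_Ioo fun t ht => ?_
          rw [← ENNReal.ofReal_ofNat, ← ENNReal.ofReal_mul (by norm_num)]
          refine ENNReal.ofReal_le_ofReal ?_
          have h1 : 1 ≤ 2 * (t ^ 2 + 1)⁻¹ := by
            rw [← div_eq_mul_inv, le_div_iff₀ (by positivity)]
            nlinarith [ht.1, ht.2]
          calc D t / |t| = D t * |t|⁻¹ * 1 := by ring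
            _ ≤ D t * |t|⁻¹ * (2 * (t ^ 2 + 1)⁻¹) := by
              have := hD0 t
              gcongr
            _ = _ := by ring
      _ ≤ ∫⁻ t, 2 * ENNReal.ofReal (D t * (|t|⁻¹ * (t ^ 2 + 1)⁻¹)) := setLIntegral_le_lintegral _ _
      _ = 2 * ∫⁻ t, ENNReal.ofReal (D t * (|t|⁻¹ * (t ^ 2 + 1)⁻¹)) :=
          lintegral_const_mul' _ _ (by simp)
      _ < ⊤ := ENNReal.mul_lt_top (by simp) (hfatou.trans_lt ENNReal.ofReal_lt_top)
  · intro hfin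
    set B := ∫⁻ t in Set.Ioo (-1) 1, ENNReal.ofReal (D t / |t|)
    set B' := ∫⁻ t : ℝ, ENNReal.ofReal (1 + t ^ 2)⁻¹ with hB'
    have hB'fin : B' < ⊤ := integrable_inv_one_add_sq.lintegral_lt_top
    have hbound : ∀ y ∈ Set.Ioo (0 : ℝ) 1,
        Real.exp (Real.log ‖F I‖ - (B + B').toReal) ≤ y * ‖F (y * I)‖ := by
      intro y hy
      have hle : ENNReal.ofReal (Real.log ‖F I‖ - Real.log (y * ‖F (y * I)‖)) ≤ B + B' := by
        rw [← key y hy.1 hy.2, ← lintegral_add_compl _ measurableSet_Ioo (A := Set.Ioo (-1) 1)]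
        refine add_le_add (setLIntegral_mono_ae' measurableSet_Ioo ?_)
          ((setLIntegral_mono_ae' measurableSet_Ioo.compl ?_).trans (setLIntegral_le_lintegral _ _))
        · filter_upwards [hne] with t ht _
          refine ENNReal.ofReal_le_ofReal (mul_le_mul_of_nonneg_left ?_ (hD0 t))
          rw [← one_div, le_div_iff₀' (abs_pos.2 ht)]
          refine (abs_mul_abs_schwarzKernel_le hy.1 hy.2 t).trans (inv_le_one_of_one_le₀ ?_)
          nlinarith [sq_nonneg t]
        · filter_upwards [hbd] with t ht hmem
          have hD1 : D t ≤ 1 := by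
            simp only [hD, Set.indicator]
            split_ifs <;> rw [abs_le] <;> constructor <;> linarith [ht.1, ht.2]
          have ht1 : 1 ≤ |t| := by
            by_contra! h
            exact hmem (abs_lt.1 h)
          refine ENNReal.ofReal_le_ofReal ?_
          calc D t * |schwarzKernel y t| ≤ |t| * |schwarzKernel y t| := by
                gcongr
                linarith
            _ ≤ (t ^ 2 + 1)⁻¹ := abs_mul_abs_schwarzKernel_le hy.1 hy.2 t
            _ = (1 + t ^ 2)⁻¹ := by rw [add_comm]
      have hsum : B + B' ≠ ⊤ := (ENNReal.add_lt_top.2 ⟨hfin, hB'fin⟩).ne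
      have hle' := (ENNReal.ofReal_le_iff_le_toReal hsum).1 hle
      have hFpos : 0 < y * ‖F (y * I)‖ := by
        refine mul_pos hy.1 (norm_pos_iff.2 fun h => ?_)
        have := him (y * I) (by simpa using hy.1)
        simp [h] at this
      rw [← Real.le_log_iff_exp_le hFpos]
      linarith
    exact (Real.exp_pos _).trans_le (ge_of_tendsto hm (hsmall.mono hbound))

section Herglotz

variable {μ : Measure ℝ}

theorem herglotz_integrand_eq {z : ℂ} (hz : 0 < z.im) (t : ℝ) :
    ((t : ℂ) - z)⁻¹ - (t : ℂ) / ((t : ℂ) ^ 2 + 1) =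
      (z + (1 + z ^ 2) * ((t : ℂ) - z)⁻¹) * (((t ^ 2 + 1)⁻¹ : ℝ) : ℂ) := by
  have h1 : (t : ℂ) - z ≠ 0 := fun h => by
    have := congrArg Complex.im h
    simp at this
    linarith
  have h2 : (t : ℂ) ^ 2 + 1 ≠ 0 := by
    have : (t ^ 2 + 1 : ℝ) ≠ 0 := by positivity
    exact_mod_cast this
  push_cast
  field_simp
  ring

theorem norm_ofReal_sub_inv_le {z : ℂ} (hz : 0 < z.im) (t : ℝ) :
    ‖((t : ℂ) - z)⁻¹‖ ≤ z.im⁻¹ := by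
  rw [norm_inv]
  refine inv_anti₀ hz ?_
  simpa [abs_of_pos hz] using Complex.abs_im_le_norm ((t : ℂ) - z)

theorem norm_herglotz_integrand_le {z : ℂ} (hz : 0 < z.im) (t : ℝ) :
    ‖((t : ℂ) - z)⁻¹ - (t : ℂ) / ((t : ℂ) ^ 2 + 1)‖ ≤
      (‖z‖ + (1 + ‖z‖ ^ 2) * z.im⁻¹) * (t ^ 2 + 1)⁻¹ := by
  rw [herglotz_integrand_eq hz, norm_mul, Complex.norm_real, Real.norm_eq_abs,
    abs_of_pos (a := (t ^ 2 + 1)⁻¹) (by positivity)]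
  gcongr
  refine (norm_add_le _ _).trans ?_
  rw [norm_mul]
  gcongr
  · exact (norm_add_le _ _).trans (by simp)
  · exact norm_ofReal_sub_inv_le hz t

theorem measurable_herglotz_integrand (z : ℂ) :
    Measurable fun t : ℝ => ((t : ℂ) - z)⁻¹ - (t : ℂ) / ((t : ℂ) ^ 2 + 1) := by
  fun_prop

theorem integrable_herglotz_integrand (hμ : Integrable (fun t : ℝ => (t ^ 2 + 1)⁻¹) μ) {z : ℂ}
    (hz : 0 < z.im) :
    Integrable (fun t : ℝ => ((t : ℂ) - z)⁻¹ - (t : ℂ) / ((t : ℂ) ^ 2 + 1)) μ :=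
  (hμ.const_mul _).mono' (measurable_herglotz_integrand z).aestronglyMeasurable
    (ae_of_all _ fun t => norm_herglotz_integrand_le hz t)

theorem norm_herglotzFn_le (hμ : Integrable (fun t : ℝ => (t ^ 2 + 1)⁻¹) μ) (a : ℝ) {b : ℝ}
    (hb : 0 ≤ b) {z : ℂ} (hz : 0 < z.im) :
    ‖herglotzFn μ a b z‖ ≤ |a| + b * ‖z‖ +
      (‖z‖ + (1 + ‖z‖ ^ 2) * z.im⁻¹) * ∫ t, (t ^ 2 + 1)⁻¹ ∂μ := by
  unfold herglotzFn
  refine (norm_add_le _ _).trans (add_le_add ((norm_add_le _ _).trans (add_le_add ?_ ?_)) ?_)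
  · simp
  · simp [abs_of_nonneg hb]
  · rw [← integral_const_mul]
    exact norm_integral_le_of_norm_le (hμ.const_mul _)
      (ae_of_all _ fun t => norm_herglotz_integrand_le hz t)

theorem le_im_herglotzFn (hμ : Integrable (fun t : ℝ => (t ^ 2 + 1)⁻¹) μ) (a : ℝ) {b : ℝ}
    (hb : 0 ≤ b) {z : ℂ} (hz : 0 < z.im) :
    z.im * (b + ∫ t, (t ^ 2 + 1)⁻¹ ∂μ) / (2 * (1 + ‖z‖ ^ 2)) ≤ (herglotzFn μ a b z).im := by
  have hInt := integrable_herglotz_integrand hμ hz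
  have him := Complex.imCLM.integral_comp_comm hInt
  simp only [Complex.imCLM_apply] at him
  have hpt : ∀ t : ℝ, z.im / (2 * (1 + ‖z‖ ^ 2)) * (t ^ 2 + 1)⁻¹ ≤
      (((t : ℂ) - z)⁻¹ - (t : ℂ) / ((t : ℂ) ^ 2 + 1)).im := by
    intro t
    have h1 : ((t : ℂ) / ((t : ℂ) ^ 2 + 1)).im = 0 := by
      rw [show (t : ℂ) / ((t : ℂ) ^ 2 + 1) = ((t / (t ^ 2 + 1) : ℝ) : ℂ) by push_cast; rfl,
        Complex.ofReal_im]
    have h2 : 0 < Complex.normSq ((t : ℂ) - z) := Complex.normSq_pos.2 fun h => by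
      have := congrArg Complex.im h
      simp at this
      linarith
    have h3 : Complex.normSq ((t : ℂ) - z) ≤ 2 * (1 + ‖z‖ ^ 2) * (t ^ 2 + 1) := by
      rw [Complex.normSq_eq_norm_sq]
      have := norm_sub_le (t : ℂ) z
      rw [Complex.norm_real, Real.norm_eq_abs] at this
      have h4 : ‖(t : ℂ) - z‖ ^ 2 ≤ (|t| + ‖z‖) ^ 2 := by gcongr
      nlinarith [sq_nonneg (|t| - ‖z‖), sq_abs t, sq_nonneg (|t| * ‖z‖), sq_nonneg ‖z‖,
        mul_nonneg (sq_nonneg t) (sq_nonneg ‖z‖)]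
    rw [Complex.sub_im, h1, sub_zero, Complex.inv_im, Complex.sub_im, Complex.ofReal_im, zero_sub,
      neg_neg, ← div_eq_mul_inv, div_div]
    gcongr
  have hle := integral_mono (hμ.const_mul (z.im / (2 * (1 + ‖z‖ ^ 2)))) hInt.im hpt
  rw [integral_const_mul] at hle
  unfold herglotzFn
  rw [Complex.add_im, Complex.add_im, ← him]
  have hb1 : z.im * b / (2 * (1 + ‖z‖ ^ 2)) ≤ b * z.im := by
    rw [div_le_iff₀ (by positivity)]
    nlinarith [mul_nonneg hb hz.le, mul_nonneg (mul_nonneg hb hz.le) (sq_nonneg ‖z‖)]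
  have hsplit : z.im * (b + ∫ t, (t ^ 2 + 1)⁻¹ ∂μ) / (2 * (1 + ‖z‖ ^ 2)) =
      z.im * b / (2 * (1 + ‖z‖ ^ 2)) + z.im / (2 * (1 + ‖z‖ ^ 2)) * ∫ t, (t ^ 2 + 1)⁻¹ ∂μ := by ring
  rw [hsplit]
  have : ((a : ℂ).im + ((b : ℂ) * z).im) = b * z.im := by simp
  rw [this]
  exact add_le_add hb1 hle

theorem differentiableOn_herglotzFn (hμ : Integrable (fun t : ℝ => (t ^ 2 + 1)⁻¹) μ) (a b : ℝ) :
    DifferentiableOn ℂ (herglotzFn μ a b) {z | 0 < z.im} := by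
  intro z₀ hz₀
  change 0 < z₀.im at hz₀
  refine DifferentiableAt.differentiableWithinAt ?_
  unfold herglotzFn
  refine DifferentiableAt.add (by fun_prop) ?_
  set s : Set ℂ := {z | z₀.im / 2 < z.im} ∩ Metric.ball z₀ 1 with hs
  have hsz : ∀ z ∈ s, 0 < z.im := fun z hz => (half_pos hz₀).trans hz.1
  have hsn : s ∈ 𝓝 z₀ := ((isOpen_lt continuous_const Complex.continuous_im).inter
    Metric.isOpen_ball).mem_nhds ⟨half_lt_self hz₀, Metric.mem_ball_self one_pos⟩
  refine (hasDerivAt_integral_of_dominated_loc_of_deriv_le (μ := μ) (s := s)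
    (F := fun z t => ((t : ℂ) - z)⁻¹ - (t : ℂ) / ((t : ℂ) ^ 2 + 1))
    (F' := fun z t => (((t : ℂ) - z) ^ 2)⁻¹)
    (bound := fun t => (2 + (1 + 2 * (‖z₀‖ + 1) ^ 2) * (z₀.im / 2)⁻¹ ^ 2) * (t ^ 2 + 1)⁻¹)
    hsn (Eventually.of_forall fun z => (measurable_herglotz_integrand z).aestronglyMeasurable)
    (integrable_herglotz_integrand hμ hz₀) (by fun_prop) ?_ (hμ.const_mul _)
    ?_).2.differentiableAt
  · refine ae_of_all _ fun t z hz => ?_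
    have hzim := hsz z hz
    set w := (t : ℂ) - z with hw
    have hw0 : 0 < ‖w‖ := norm_pos_iff.2 fun h => by
      have := congrArg Complex.im h
      simp [hw] at this
      linarith
    have hinv : ‖w‖⁻¹ ≤ (z₀.im / 2)⁻¹ := by
      rw [← norm_inv]
      exact (norm_ofReal_sub_inv_le hzim t).trans (inv_anti₀ (half_pos hz₀) hz.1.le)
    have hzn : ‖z‖ ≤ ‖z₀‖ + 1 := by
      have h1 := hz.2
      rw [mem_ball_iff_norm] at h1
      have := norm_add_le (z - z₀) z₀
      rw [sub_add_cancel] at this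
      linarith
    have ht : t ^ 2 + 1 ≤ 2 * ‖w‖ ^ 2 + (1 + 2 * (‖z₀‖ + 1) ^ 2) := by
      have h1 : |t| ≤ ‖w‖ + ‖z‖ := by
        have := norm_add_le w z
        rwa [hw, sub_add_cancel, Complex.norm_real, Real.norm_eq_abs] at this
      have h2 : |t| ^ 2 ≤ (‖w‖ + ‖z‖) ^ 2 := by gcongr
      have h3 : ‖z‖ ^ 2 ≤ (‖z₀‖ + 1) ^ 2 := by gcongr
      rw [sq_abs] at h2
      nlinarith [sq_nonneg (‖w‖ - ‖z‖)]
    rw [norm_inv, norm_pow, ← div_eq_mul_inv, le_div_iff₀ (by positivity)]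
    calc (‖w‖ ^ 2)⁻¹ * (t ^ 2 + 1)
        ≤ (‖w‖ ^ 2)⁻¹ * (2 * ‖w‖ ^ 2 + (1 + 2 * (‖z₀‖ + 1) ^ 2)) := by gcongr
      _ = 2 + (1 + 2 * (‖z₀‖ + 1) ^ 2) * ‖w‖⁻¹ ^ 2 := by
        field_simp
      _ ≤ _ := by gcongr
  · refine ae_of_all _ fun t z hz => ?_
    have hne : (t : ℂ) - z ≠ 0 := fun h => by
      have := congrArg Complex.im h
      have := hsz z hz
      simp at *
      linarith
    have h1 : HasDerivAt (fun z : ℂ => (t : ℂ) - z) (-1) z := by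
      simpa using (hasDerivAt_id z).const_sub (t : ℂ)
    simpa using (h1.inv hne).sub_const ((t : ℂ) / ((t : ℂ) ^ 2 + 1))

theorem exists_norm_log_herglotzFn_le (hμ : Integrable (fun t : ℝ => (t ^ 2 + 1)⁻¹) μ) (a : ℝ)
    {b : ℝ} (hb : 0 ≤ b) (hpos : 0 < b + ∫ t, (t ^ 2 + 1)⁻¹ ∂μ) {h : ℝ} (hh : 0 < h) :
    ∃ M, 0 ≤ M ∧ ∀ z : ℂ, h ≤ z.im → ‖Complex.log (herglotzFn μ a b z)‖ ≤ M * (1 + ‖z‖) := by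
  set c₀ := ∫ t, (t ^ 2 + 1)⁻¹ ∂μ
  have hc₀ : 0 ≤ c₀ := integral_nonneg fun t => by positivity
  set c := h * (b + c₀) / 2 with hc
  set C := |a| + b + (1 + h⁻¹) * c₀ + 1 with hC
  have hcpos : 0 < c := by positivity
  have hCpos : 0 < C := by positivity
  refine ⟨|Real.log c| + |Real.log C| + Real.pi + 2, by positivity, fun z hz => ?_⟩
  have hz0 : 0 < z.im := hh.trans_le hz
  set N := 1 + ‖z‖ with hN
  have hN1 : 1 ≤ N := by linarith [norm_nonneg z]
  have hlow : c / N ^ 2 ≤ ‖herglotzFn μ a b z‖ := by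
    refine le_trans ?_ ((le_im_herglotzFn hμ a hb hz0).trans
      ((le_abs_self _).trans (Complex.abs_im_le_norm _)))
    rw [hc, div_div]
    gcongr
    nlinarith [norm_nonneg z]
  have hup : ‖herglotzFn μ a b z‖ ≤ C * N ^ 2 := by
    refine (norm_herglotzFn_le hμ a hb hz0).trans ?_
    have h1 : ‖z‖ + (1 + ‖z‖ ^ 2) * z.im⁻¹ ≤ (1 + h⁻¹) * N ^ 2 := by
      have : (1 + ‖z‖ ^ 2) * z.im⁻¹ ≤ N ^ 2 * h⁻¹ := by
        gcongr
        nlinarith [norm_nonneg z]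
      nlinarith [norm_nonneg z]
    have h2 : (‖z‖ + (1 + ‖z‖ ^ 2) * z.im⁻¹) * c₀ ≤ (1 + h⁻¹) * N ^ 2 * c₀ := by gcongr
    have h3 : |a| ≤ |a| * N ^ 2 := le_mul_of_one_le_right (abs_nonneg a) (one_le_pow₀ hN1)
    have h4 : b * ‖z‖ ≤ b * N ^ 2 := by
      gcongr
      nlinarith [norm_nonneg z]
    nlinarith [sq_nonneg N]
  have hFpos : 0 < ‖herglotzFn μ a b z‖ := lt_of_lt_of_le (by positivity) hlow
  have hlogN : Real.log N ≤ ‖z‖ := by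
    have := Real.log_le_sub_one_of_pos (by linarith : 0 < N)
    linarith
  have hl := Real.log_le_log (by positivity) hlow
  have hu := Real.log_le_log hFpos hup
  rw [Real.log_div hcpos.ne' (by positivity), Real.log_pow] at hl
  rw [Real.log_mul hCpos.ne' (by positivity), Real.log_pow] at hu
  push_cast at hl hu
  have hre : |(Complex.log (herglotzFn μ a b z)).re| ≤
      |Real.log c| + |Real.log C| + 2 * ‖z‖ := by
    rw [Complex.log_re, abs_le]
    constructor <;> linarith [neg_abs_le (Real.log c), le_abs_self (Real.log C),
      abs_nonneg (Real.log c), abs_nonneg (Real.log C)]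
  have him : |(Complex.log (herglotzFn μ a b z)).im| ≤ Real.pi := by
    rw [Complex.log_im]
    exact Complex.abs_arg_le_pi _
  have := Complex.norm_le_abs_re_add_abs_im (Complex.log (herglotzFn μ a b z))
  have hrest : 0 ≤ (|Real.log c| + |Real.log C| + Real.pi) * ‖z‖ := by positivity
  nlinarith [norm_nonneg z]

open Complex in
theorem tendsto_mul_norm_herglotzFn (hμ : Integrable (fun t : ℝ => (t ^ 2 + 1)⁻¹) μ) (a b x : ℝ) :
    Tendsto (fun y : ℝ => y * ‖herglotzFn μ a b (x + y * I)‖) (𝓝[>] 0) (𝓝 (μ.real {x})) := by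
  have hInt : Tendsto (fun y : ℝ => ∫ t : ℝ, (y : ℂ) *
      (((t : ℂ) - (x + y * I))⁻¹ - (t : ℂ) / ((t : ℂ) ^ 2 + 1)) ∂μ) (𝓝[>] 0)
      (𝓝 (∫ t : ℝ, ({x} : Set ℝ).indicator (fun _ => I) t ∂μ)) := by
    refine tendsto_integral_filter_of_dominated_convergence
      (fun t => (|x| + 1 + (1 + (|x| + 1) ^ 2)) * (t ^ 2 + 1)⁻¹) ?_ ?_ (hμ.const_mul _) ?_
    · exact Eventually.of_forall fun y =>
        ((measurable_herglotz_integrand _).const_mul _).aestronglyMeasurable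
    · filter_upwards [Ioo_mem_nhdsGT one_pos] with y hy
      refine ae_of_all _ fun t => ?_
      have him : (x + y * I : ℂ).im = y := by simp
      have hn : ‖(x + y * I : ℂ)‖ ≤ |x| + 1 := by
        refine (norm_add_le _ _).trans ?_
        rw [norm_mul, norm_I, norm_real, norm_real, Real.norm_eq_abs, Real.norm_eq_abs,
          abs_of_pos hy.1]
        linarith [hy.2]
      have hle := norm_herglotz_integrand_le (z := x + y * I) (by rw [him]; exact hy.1) t
      rw [him] at hle
      rw [norm_mul, norm_real, Real.norm_eq_abs, abs_of_pos hy.1]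
      have hy0 := hy.1
      calc y * ‖((t : ℂ) - (x + y * I))⁻¹ - (t : ℂ) / ((t : ℂ) ^ 2 + 1)‖
          ≤ y * ((‖(x + y * I : ℂ)‖ + (1 + ‖(x + y * I : ℂ)‖ ^ 2) * y⁻¹) * (t ^ 2 + 1)⁻¹) := by
            gcongr
        _ = (y * ‖(x + y * I : ℂ)‖ + (1 + ‖(x + y * I : ℂ)‖ ^ 2)) * (t ^ 2 + 1)⁻¹ := by
            field_simp
        _ ≤ (1 * (|x| + 1) + (1 + (|x| + 1) ^ 2)) * (t ^ 2 + 1)⁻¹ := by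
            gcongr
            exact hy.2.le
        _ = _ := by rw [one_mul]
    · refine ae_of_all _ fun t => ?_
      have hy0 : Tendsto (fun y : ℝ => (y : ℂ)) (𝓝[>] 0) (𝓝 0) :=
        tendsto_nhdsWithin_of_tendsto_nhds (Continuous.tendsto' (by fun_prop) _ _ (by simp))
      by_cases ht : t = x
      · subst ht
        rw [Set.indicator_of_mem (Set.mem_singleton t)]
        have h1 : Tendsto (fun y : ℝ => I - (y : ℂ) * ((t : ℂ) / ((t : ℂ) ^ 2 + 1))) (𝓝[>] 0)
            (𝓝 I) := by
          simpa using (hy0.mul_const ((t : ℂ) / ((t : ℂ) ^ 2 + 1))).const_sub I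
        refine h1.congr' ?_
        filter_upwards [self_mem_nhdsWithin] with y hy
        have hyne : (y : ℂ) ≠ 0 := ofReal_ne_zero.2 (ne_of_gt hy)
        rw [sub_add_cancel_left, inv_neg, mul_inv, inv_I, mul_sub]
        congr 1
        field_simp
      · rw [Set.indicator_of_notMem (by simpa using ht)]
        have hne : (t : ℂ) - x ≠ 0 := sub_ne_zero.2 (ofReal_injective.ne ht)
        have h1 : Tendsto (fun y : ℝ => (t : ℂ) - (x + y * I)) (𝓝[>] 0) (𝓝 ((t : ℂ) - x)) := by
          simpa using ((hy0.mul_const I).const_add (x : ℂ)).const_sub (t : ℂ)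
        simpa using hy0.mul ((h1.inv₀ hne).sub_const ((t : ℂ) / ((t : ℂ) ^ 2 + 1)))
  have hlin : Tendsto (fun y : ℝ => (y : ℂ) * ((a : ℂ) + b * (x + y * I))) (𝓝[>] 0) (𝓝 0) :=
    tendsto_nhdsWithin_of_tendsto_nhds (Continuous.tendsto' (by fun_prop) _ _ (by simp))
  have hsum := (hlin.add hInt).norm
  rw [integral_indicator_const _ (measurableSet_singleton x), zero_add, norm_smul, norm_I, mul_one,
    Real.norm_of_nonneg measureReal_nonneg] at hsum
  refine hsum.congr' ?_
  filter_upwards [self_mem_nhdsWithin] with y hy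
  rw [integral_const_mul, ← mul_add, norm_mul, norm_real, Real.norm_of_nonneg (le_of_lt hy)]
  rfl

theorem measure_singleton_lt_top (hμ : Integrable (fun t : ℝ => (t ^ 2 + 1)⁻¹) μ) (x : ℝ) :
    μ {x} < ⊤ := by
  refine (measure_mono ?_).trans_lt
    (hμ.measure_norm_ge_lt_top (ε := (x ^ 2 + 1)⁻¹) (by positivity))
  rintro _ rfl
  exact Real.le_norm_self _

theorem eq_zero_of_integral_eq_zero (hμ : Integrable (fun t : ℝ => (t ^ 2 + 1)⁻¹) μ)
    (h : ∫ t, (t ^ 2 + 1)⁻¹ ∂μ = 0) : μ = 0 := by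
  rw [integral_eq_zero_iff_of_nonneg (fun t => by positivity) hμ] at h
  refine ae_eq_bot.1 (eventually_false_iff_eq_bot.1 ?_)
  filter_upwards [h] with t ht
  have : (0 : ℝ) < (t ^ 2 + 1)⁻¹ := by positivity
  exact this.ne' ht

end Herglotz

theorem setLIntegral_Ioo_inv_abs_eq_top {u v x : ℝ} (huv : u < v) (hx : x ∈ Set.Icc u v) :
    ∫⁻ t in Set.Ioo u v, ENNReal.ofReal (1 / |t - x|) = ⊤ := by
  by_contra h
  have hInt : IntegrableOn (fun t => (t - x)⁻¹) (Set.Ioo u v) := by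
    refine ⟨by fun_prop, ?_⟩
    rw [hasFiniteIntegral_iff_norm]
    simpa using lt_top_iff_ne_top.2 h
  rw [← intervalIntegrable_iff_integrableOn_Ioo_of_le huv.le, intervalIntegrable_sub_inv_iff,
    Set.uIcc_of_le huv.le] at hInt
  exact hInt.elim huv.ne fun h => h hx

theorem setLIntegral_abs_sub_indicator_eq_top {ξ : ℝ → ℝ} (x : ℝ)
    (h : (∀ᵐ t, ξ t = 0) ∨ ∀ᵐ t, ξ t = 1) :
    ∫⁻ t in Set.Ioo (x - 1) (x + 1),
      ENNReal.ofReal (|ξ t - (Set.Ioi x).indicator (fun _ => (1 : ℝ)) t| / |t - x|) = ⊤ := by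
  rcases h with h | h
  · refine top_le_iff.1 ((setLIntegral_Ioo_inv_abs_eq_top (lt_add_one x)
      ⟨le_rfl, (lt_add_one x).le⟩).symm.le.trans
      (le_trans (setLIntegral_mono_ae' measurableSet_Ioo ?_)
        (lintegral_mono_set (Set.Ioo_subset_Ioo_left (sub_one_lt x).le))))
    filter_upwards [h] with t ht hmem
    simp [ht, Set.indicator_of_mem (Set.mem_Ioi.2 hmem.1)]
  · refine top_le_iff.1 ((setLIntegral_Ioo_inv_abs_eq_top (sub_one_lt x)
      ⟨(sub_one_lt x).le, le_rfl⟩).symm.le.trans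
      (le_trans (setLIntegral_mono_ae' measurableSet_Ioo ?_)
        (lintegral_mono_set (Set.Ioo_subset_Ioo_right (lt_add_one x).le))))
    filter_upwards [h] with t ht hmem
    simp [ht, Set.indicator_of_notMem (show t ∉ Set.Ioi x from not_lt.2 hmem.2.le)]

/-- Lemma 2.2: let `μ` be a positive Borel measure with `∫ dμ(t)/(t²+1) < ∞`, let
`F_μ(z) = a + bz + ∫ (1/(t-z) - t/(t²+1)) dμ(t)` (with `b ≥ 0`) be an associated
Herglotz function, and let `ξ` be its Krein function, i.e.
`π ξ(x) = lim_{y→0+} Im ln F_μ(x+iy)` for Lebesgue-a.e. `x` (with the branch of the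
logarithm satisfying `0 < Im ln w < π` on the upper half plane, which is Lean's
`Complex.log` there).  Then `μ({x}) > 0` if and only if
`∫_{x-1}^{x+1} |ξ(t) - χ_{(x,∞)}(t)|/|t-x| dt < ∞`. -/
theorem point_mass_iff_krein_integral_finite
    (μ : Measure ℝ) (hμint : Integrable (fun t : ℝ => (t ^ 2 + 1)⁻¹) μ)
    (a b : ℝ) (hb : 0 ≤ b)
    (ξ : ℝ → ℝ)
    (hξ : ∀ᵐ x : ℝ, Tendsto
      (fun y : ℝ => (Complex.log (herglotzFn μ a b ((x : ℂ) + y * Complex.I))).im)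
      (𝓝[>] (0 : ℝ)) (𝓝 (Real.pi * ξ x)))
    (x : ℝ) :
    0 < μ {x} ↔
      ∫⁻ t in Set.Ioo (x - 1) (x + 1),
        ENNReal.ofReal (|ξ t - (Set.Ioi x).indicator (fun _ => (1 : ℝ)) t| / |t - x|) < ⊤ := by
  have hmass : 0 < μ {x} ↔ 0 < μ.real {x} := by
    rw [measureReal_def, ENNReal.toReal_pos_iff]
    exact ⟨fun h => ⟨h, measure_singleton_lt_top hμint x⟩, fun h => h.1⟩
  rw [hmass]
  have hc₀ : 0 ≤ ∫ t, (t ^ 2 + 1)⁻¹ ∂μ := integral_nonneg fun t => by positivity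
  rcases (add_nonneg hb hc₀).eq_or_lt with hzero | hpos
  · have hμ0 : μ = 0 := eq_zero_of_integral_eq_zero hμint (by linarith)
    have hb0 : b = 0 := by linarith
    subst hμ0 hb0
    have hξa : ∀ᵐ t : ℝ, Real.pi * ξ t = Complex.arg a := by
      filter_upwards [hξ] with t ht
      refine tendsto_nhds_unique ht ?_
      simp [herglotzFn, Complex.log_im]
    rw [setLIntegral_abs_sub_indicator_eq_top x]
    · simp
    · rcases le_or_gt 0 a with ha | ha
      · left
        filter_upwards [hξa] with t ht
        simpa [Complex.arg_ofReal_of_nonneg ha, Real.pi_ne_zero] using ht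
      · right
        filter_upwards [hξa] with t ht
        simpa [Complex.arg_ofReal_of_neg ha, Real.pi_ne_zero] using ht
  · have him : ∀ z : ℂ, 0 < z.im → 0 < (herglotzFn μ a b (x + z)).im := fun z hz => by
      have hz' : 0 < (x + z : ℂ).im := by simpa using hz
      exact lt_of_lt_of_le (by positivity) (le_im_herglotzFn hμint a hb hz')
    have hcore := pos_iff_lintegral_krein_lt_top (F := fun z => herglotzFn μ a b (x + z))
      (ξ := fun t => ξ (x + t)) ((differentiableOn_herglotzFn hμint a b).comp (by fun_prop)
        fun z hz => by simpa using hz) him ?_ ?_ (tendsto_mul_norm_herglotzFn hμint a b x)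
    · rw [hcore]
      have hpre : (fun t => x + t) ⁻¹' Set.Ioo (x - 1) (x + 1) = Set.Ioo (-1) 1 := by
        ext t
        simp [sub_eq_add_neg]
      rw [← (measurePreserving_add_left volume x).setLIntegral_comp_preimage_emb
        (measurableEmbedding_addLeft x) _ (Set.Ioo (x - 1) (x + 1)), hpre]
      simp [Set.indicator]
    · intro h hh
      obtain ⟨M, hM0, hM⟩ := exists_norm_log_herglotzFn_le hμint a hb hpos hh
      refine ⟨M * (1 + |x|), fun z hz => (hM _ (by simpa using hz)).trans ?_⟩
      rw [mul_assoc]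
      gcongr
      have := norm_add_le (x : ℂ) z
      rw [Complex.norm_real, Real.norm_eq_abs] at this
      nlinarith [mul_nonneg (abs_nonneg x) (norm_nonneg z)]
    · have hq := (measurePreserving_add_left (volume : Measure ℝ) x).quasiMeasurePreserving.ae hξ
      filter_upwards [hq] with t ht
      simpa [add_assoc] using ht
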